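/- Let ℙ be the forcing notion whose conditions and order are defined in the context. Then ℙ has the Knaster property: for every sequence ⟨p_ξ : ξ < ω₁⟩ of conditions from ℙ there is an uncountable set A ⊆ ω₁ such that for all ξ, ζ ∈ A the conditions p_ξ and p_ζ are compatible (i.e., have a common upper bound in ℙ). -/

import Mathlib

/-- The set of countable ordinals, i.e. ω₁ viewed as a type. -/
abbrev Omega1 : Type 1 := {o : Ordinal.{0} // o < (Cardinal.aleph 1).ord}

/-- Coordinatewise addition modulo 2 of two 0-1 sequences (of the same length). -/
def addL (σ τ : List Bool) : List Bool := List.zipWith xor σ τ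

/-- Interpret a finite 0-1 sequence as a vector over GF(2) (inside `ℕ → ZMod 2`). -/
def toVec (σ : List Bool) : ℕ → ZMod 2 :=
  fun i => if h : i < σ.length then (if σ.get ⟨i, h⟩ then 1 else 0) else 0

/-- A condition of the forcing notion ℙ. -/
structure Cond where
  /-- `u` : a nonempty finite subset of ω₁ -/
  u : Finset Omega1
  /-- the length `n` -/
  n : ℕ
  /-- the number `m_*` of trees -/
  mstar : ℕ
  /-- `η̄ = ⟨η_α : α ∈ u⟩ ⊆ ^n2` -/
  η : Omega1 → List Bool
  /-- `t̄ = ⟨t_m : m < m_*⟩` -/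
  t : ℕ → Set (List Bool)
  /-- the first component `ρ_{α,β}` of `μ(α,β)` -/
  ρ : Omega1 → Omega1 → List Bool
  /-- the second component `ℓ_{α,β}` of `μ(α,β)` -/
  ℓ : Omega1 → Omega1 → ℕ
  /-- `K : u → m_*` -/
  K : Omega1 → ℕ
  hu : u.Nonempty
  hn : 0 < n
  hm : 0 < mstar
  hη : ∀ a ∈ u, (η a).length = n
  /-- each `t_m ⊆ ^{n≥}2` is a tree with all maximal nodes of length `n` -/
  htree : ∀ m < mstar, (∀ σ ∈ t m, σ.length ≤ n) ∧
    (∀ σ ∈ t m, ∀ τ, τ <+: σ → τ ∈ t m) ∧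
    (∀ σ ∈ t m, σ.length < n → ∃ τ ∈ t m, σ <+: τ ∧ σ ≠ τ)
  hρlen : ∀ a ∈ u, ∀ b ∈ u, a ≠ b → (ρ a b).length = n
  hρsym : ∀ a b, ρ a b = ρ b a
  hℓsym : ∀ a b, ℓ a b = ℓ b a
  hℓlt : ∀ a ∈ u, ∀ b ∈ u, a ≠ b → ℓ a b < mstar
  /-- (4): `η_α + ρ_{α,β}, η_β + ρ_{α,β} ∈ t_{ℓ_{α,β}}` -/
  h4 : ∀ a ∈ u, ∀ b ∈ u, a ≠ b →
    addL (η a) (ρ a b) ∈ t (ℓ a b) ∧ addL (η b) (ρ a b) ∈ t (ℓ a b)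
  /-- (5): `K_α < m_*` and `η_α ∈ t_{K_α}` -/
  h5 : ∀ a ∈ u, K a < mstar ∧ η a ∈ t (K a)
  /-- (6): for `α < β < γ` in `u`, `{K_α, K_γ, ℓ_{α,γ}} ≠ {K_β, K_γ, ℓ_{β,γ}}` -/
  h6 : ∀ a ∈ u, ∀ b ∈ u, ∀ c ∈ u, a < b → b < c →
    ({K a, K c, ℓ a c} : Set ℕ) ≠ ({K b, K c, ℓ b c} : Set ℕ)
  /-- (7): for `m < m' < m_*`, `t_m ∩ t_{m'} ∩ ^n2 = ∅` -/
  h7 : ∀ m m', m < m' → m' < mstar →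
    ∀ σ, σ.length = n → σ ∈ t m → σ ∉ t m'
  /-- (8): `t_m ∩ ^n2 ⊆ {η_α + ρ_{α,β}} ∪ {η_α}` -/
  h8 : ∀ m < mstar, ∀ σ ∈ t m, σ.length = n →
    (∃ a ∈ u, σ = η a) ∨ (∃ a ∈ u, ∃ b ∈ u, a ≠ b ∧ σ = addL (η a) (ρ a b))
  /-- (9): `⟨η_α : α ∈ u⟩⌢⟨ρ_{α,β} : α < β in u⟩` is linearly independent over GF(2) -/
  h9 : LinearIndependent (ZMod 2)
    (Sum.elim (fun a : {a : Omega1 // a ∈ u} => toVec (η a))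
      (fun q : {q : Omega1 × Omega1 // q.1 ∈ u ∧ q.2 ∈ u ∧ q.1 < q.2} =>
        toVec (ρ q.1.1 q.1.2)))

/-- The order of ℙ (`p ≤ q` : `q` is a stronger condition than `p`). -/
def Cond.Le (p q : Cond) : Prop :=
  p.u ⊆ q.u ∧ p.n ≤ q.n ∧ p.mstar ≤ q.mstar ∧
  (∀ a ∈ p.u, (q.η a).take p.n = p.η a) ∧
  (∀ m < p.mstar, ∀ σ : List Bool, σ.length = p.n → (σ ∈ q.t m ↔ σ ∈ p.t m)) ∧
  (∀ a ∈ p.u, q.K a = p.K a) ∧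
  (∀ a ∈ p.u, ∀ b ∈ p.u, a ≠ b → q.ℓ a b = p.ℓ a b ∧ p.ρ a b <+: q.ρ a b)


open Set

section Sunflower

variable {ι α : Type*}

theorem exists_not_countable_fiber {γ : Type*} [Countable γ] {A : Set ι}
    (hA : ¬ A.Countable) (g : ι → γ) : ∃ c, ¬ {i ∈ A | g i = c}.Countable := by
  by_contra! h
  refine hA ((countable_iUnion h).mono fun i hi => ?_)
  simp [hi]

theorem exists_not_countable_pairwiseDisjoint [DecidableEq α] {A : Set ι} (hA : ¬ A.Countable)
    (u : ι → Finset α) (h : ∀ a, {i ∈ A | a ∈ u i}.Countable) :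
    ∃ B ⊆ A, ¬ B.Countable ∧ B.PairwiseDisjoint u := by
  obtain ⟨B, hB⟩ := zorn_subset {B : Set ι | B ⊆ A ∧ B.PairwiseDisjoint u} (by
    intro c hc hchain
    refine ⟨⋃₀ c, ⟨sUnion_subset fun s hs => (hc hs).1, ?_⟩, fun s hs => subset_sUnion_of_mem hs⟩
    exact (pairwise_sUnion hchain.directedOn).2 fun s hs => (hc hs).2)
  refine ⟨B, hB.prop.1, fun hcount => hA ?_, hB.prop.2⟩
  have hmeet : (⋃ i ∈ B, ⋃ a ∈ u i, {j ∈ A | a ∈ u j}).Countable :=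
    hcount.biUnion fun i _ => (u i).countable_toSet.biUnion fun a _ => h a
  refine (hcount.union hmeet).mono fun j hj => ?_
  by_contra hj'
  simp only [mem_union, mem_iUnion, mem_ofPred_eq, not_or, not_exists, not_and] at hj'
  have hins : insert j B ∈ {B : Set ι | B ⊆ A ∧ B.PairwiseDisjoint u} := by
    refine ⟨insert_subset hj hB.prop.1, hB.prop.2.insert fun i hi _ => ?_⟩
    exact Finset.disjoint_left.2 fun a haj hai => hj'.2 i hi a hai hj haj
  exact hj'.1 (hB.le_of_ge hins (subset_insert j B) (mem_insert j B))

/-- The `Δ`-system lemma for uncountable families of finite sets of the same size. -/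
theorem exists_not_countable_sunflower_of_card [DecidableEq α] (k : ℕ) :
    ∀ {A : Set ι}, ¬ A.Countable → ∀ u : ι → Finset α, (∀ i ∈ A, (u i).card = k) →
    ∃ w : Finset α, ∃ B ⊆ A, ¬ B.Countable ∧ (∀ i ∈ B, w ⊆ u i) ∧
      B.PairwiseDisjoint fun i => u i \ w := by
  induction k with
  | zero =>
    intro A hA u hu
    refine ⟨∅, A, subset_rfl, hA, by simp, fun i hi j _ _ => ?_⟩
    simp [Function.onFun, Finset.card_eq_zero.1 (hu i hi)]
  | succ k ih =>
    intro A hA u hu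
    by_cases h : ∀ a, {i ∈ A | a ∈ u i}.Countable
    · obtain ⟨B, hBA, hB, hd⟩ := exists_not_countable_pairwiseDisjoint hA u h
      exact ⟨∅, B, hBA, hB, by simp, by simpa using hd⟩
    · push Not at h
      obtain ⟨a, ha⟩ := h
      obtain ⟨w, B, hBA, hB, hw, hd⟩ := ih ha (fun i => (u i).erase a)
        (fun i hi => by rw [Finset.card_erase_of_mem hi.2, hu i hi.1]; rfl)
      refine ⟨insert a w, B, fun i hi => (hBA hi).1, hB, fun i hi => ?_, ?_⟩
      · exact Finset.insert_subset (hBA hi).2 ((hw i hi).trans (Finset.erase_subset _ _))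
      · convert hd using 2 with i
        ext x
        simp only [Finset.mem_sdiff, Finset.mem_insert, Finset.mem_erase]
        tauto

/-- The `Δ`-system lemma for uncountable families of finite sets. -/
theorem exists_not_countable_sunflower [DecidableEq α] {A : Set ι} (hA : ¬ A.Countable)
    (u : ι → Finset α) :
    ∃ w : Finset α, ∃ B ⊆ A, ¬ B.Countable ∧ (∀ i ∈ B, w ⊆ u i) ∧
      B.PairwiseDisjoint fun i => u i \ w := by
  obtain ⟨k, hk⟩ := exists_not_countable_fiber hA fun i => (u i).card
  obtain ⟨w, B, hBA, h⟩ := exists_not_countable_sunflower_of_card k hk u fun i hi => hi.2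
  exact ⟨w, B, fun i hi => (hBA hi).1, h⟩

/-- Removing countably many members of a `Δ`-system makes the petals avoid a countable set. -/
theorem not_countable_setOf_disjoint [DecidableEq α] {B : Set ι} (hB : ¬ B.Countable)
    {v : ι → Finset α} (hd : B.PairwiseDisjoint v) {s : Set α} (hs : s.Countable) :
    ¬ {i ∈ B | ∀ a ∈ v i, a ∉ s}.Countable := by
  intro h
  have hmeet : (⋃ a ∈ s, {i ∈ B | a ∈ v i}).Countable := by
    refine hs.biUnion fun a _ => Subsingleton.countable fun i hi j hj => ?_
    by_contra hij
    exact Finset.disjoint_left.1 (hd hi.1 hj.1 hij) hi.2 hj.2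
  refine hB ((h.union hmeet).mono fun i hi => ?_)
  by_cases h' : ∀ a ∈ v i, a ∉ s
  · exact Or.inl ⟨hi, h'⟩
  · push Not at h'
    obtain ⟨a, ha, has⟩ := h'
    exact Or.inr (mem_biUnion has ⟨hi, ha⟩)

end Sunflower

theorem Omega1.not_countable_univ : ¬ (univ : Set Omega1).Countable := by
  rw [← Cardinal.le_aleph0_iff_set_countable, Cardinal.mk_univ, not_le]
  have := Cardinal.mk_Iio_ordinal (Cardinal.aleph 1).ord
  rw [Cardinal.card_ord] at this
  change _ < Cardinal.mk (Iio (Cardinal.aleph 1).ord)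
  rw [this]
  simp

theorem Omega1.countable_Iic (a : Omega1) : (Iic a).Countable := by
  have h : (Iio (Order.succ a.1)).Countable := by
    rw [← Cardinal.le_aleph0_iff_set_countable, Cardinal.mk_Iio_ordinal, Cardinal.lift_le_aleph0,
      ← Order.lt_succ_iff, Cardinal.succ_aleph0, ← Cardinal.lt_ord]
    exact (Cardinal.isSuccLimit_ord (Cardinal.aleph0_le_aleph 1)).succ_lt a.2
  refine (h.preimage Subtype.val_injective).mono fun b hb => ?_
  exact mem_preimage.2 (mem_Iio.2 (Order.lt_succ_iff.2 (Subtype.coe_le_coe.2 hb)))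

/-- The sequence of length `N` with a single `1`, at position `k`. -/
def unitSeq (N k : ℕ) : List Bool := (List.range N).map fun i => decide (i = k)

@[simp] theorem length_unitSeq (N k : ℕ) : (unitSeq N k).length = N := by simp [unitSeq]

theorem addL_append {σ σ' τ τ' : List Bool} (h : σ.length = σ'.length) :
    addL (σ ++ τ) (σ' ++ τ') = addL σ σ' ++ addL τ τ' :=
  List.zipWith_append h

theorem length_addL {σ τ : List Bool} {n : ℕ} (hσ : σ.length = n) (hτ : τ.length = n) :
    (addL σ τ).length = n := by
  simp [addL, hσ, hτ]

theorem getElem_addL_unitSeq {N i j k : ℕ} (hk : k < N) :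
    (addL (unitSeq N i) (unitSeq N j))[k]? = some (xor (decide (k = i)) (decide (k = j))) := by
  simp [addL, unitSeq, hk]

theorem getElem_unitSeq {N i k : ℕ} (hk : k < N) :
    (unitSeq N i)[k]? = some (decide (k = i)) := by
  simp [unitSeq, hk]

theorem toVec_append_unitSeq {σ : List Bool} {N k : ℕ} (hk : k < N) (i : ℕ) :
    toVec (σ ++ unitSeq N k) (σ.length + i) = (Pi.single k 1 : ℕ → ZMod 2) i := by
  by_cases hi : i < N
  · simp [toVec, hi, unitSeq, Pi.single_apply, List.getElem_append_right]
  · have : i ≠ k := by omega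
    simp [toVec, hi, this]

/-- The node `η_a` when `a = b`, and the node `η_a + ρ_{a,b}` otherwise. -/
noncomputable def topNode (η : Omega1 → List Bool) (ρ : Omega1 → Omega1 → List Bool) (a b : Omega1) :
    List Bool := if a = b then η a else addL (η a) (ρ a b)

/-- The index of the tree containing `topNode η ρ a b`. -/
noncomputable def topLabel (K : Omega1 → ℕ) (ℓ : Omega1 → Omega1 → ℕ) (a b : Omega1) : ℕ :=
  if a = b then K a else ℓ a b

namespace Cond

theorem topLabel_lt (p : Cond) {a b : Omega1} (ha : a ∈ p.u) (hb : b ∈ p.u) :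
    topLabel p.K p.ℓ a b < p.mstar := by
  unfold topLabel
  split_ifs with h
  · exact (p.h5 a ha).1
  · exact p.hℓlt a ha b hb h

theorem topNode_mem (p : Cond) {a b : Omega1} (ha : a ∈ p.u) (hb : b ∈ p.u) :
    topNode p.η p.ρ a b ∈ p.t (topLabel p.K p.ℓ a b) := by
  unfold topLabel topNode
  split_ifs with h
  · exact (p.h5 a ha).2
  · exact (p.h4 a ha b hb h).1

theorem mem_t_iff (p : Cond) {m : ℕ} (hm : m < p.mstar) {σ : List Bool} (hσ : σ.length = p.n) :
    σ ∈ p.t m ↔ ∃ a ∈ p.u, ∃ b ∈ p.u,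
      topLabel p.K p.ℓ a b = m ∧ σ = topNode p.η p.ρ a b := by
  constructor
  · intro h
    obtain ⟨a, ha, b, hb, rfl⟩ : ∃ a ∈ p.u, ∃ b ∈ p.u, σ = topNode p.η p.ρ a b := by
      obtain ⟨a, ha, rfl⟩ | ⟨a, ha, b, hb, hab, rfl⟩ := p.h8 m hm σ h hσ
      · exact ⟨a, ha, a, ha, by simp [topNode]⟩
      · exact ⟨a, ha, b, hb, by simp [topNode, hab]⟩
    refine ⟨a, ha, b, hb, ?_, rfl⟩
    have h' := p.topNode_mem ha hb
    obtain hlt | heq | hgt := lt_trichotomy (topLabel p.K p.ℓ a b) m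
    · exact absurd h (p.h7 _ _ hlt hm _ hσ h')
    · exact heq
    · exact absurd h' (p.h7 _ _ hgt (p.topLabel_lt ha hb) _ hσ h)
  · rintro ⟨a, ha, b, hb, rfl, rfl⟩
    exact p.topNode_mem ha hb

theorem Le.refl (p : Cond) : p.Le p :=
  ⟨subset_rfl, le_rfl, le_rfl, fun a ha => by simp [← p.hη a ha], fun _ _ _ _ => Iff.rfl,
    fun _ _ => rfl, fun _ _ _ _ _ => ⟨rfl, List.prefix_rfl⟩⟩

end Cond

/-- All the data of a condition except for the trees and for linear independence, together with
a code `e` of the (possibly degenerate) unordered pairs from `u` by numbers below `N`. -/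
structure PreCond where
  u : Finset Omega1
  n : ℕ
  mstar : ℕ
  η : Omega1 → List Bool
  ρ : Omega1 → Omega1 → List Bool
  ℓ : Omega1 → Omega1 → ℕ
  K : Omega1 → ℕ
  e : Sym2 Omega1 → ℕ
  N : ℕ
  nonempty : u.Nonempty
  n_pos : 0 < n
  length_η : ∀ a ∈ u, (η a).length = n
  length_ρ : ∀ a ∈ u, ∀ b ∈ u, a ≠ b → (ρ a b).length = n
  ρ_symm : ∀ a b, ρ a b = ρ b a
  ℓ_symm : ∀ a b, ℓ a b = ℓ b a
  ℓ_lt : ∀ a ∈ u, ∀ b ∈ u, a ≠ b → ℓ a b < mstar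
  K_lt : ∀ a ∈ u, K a < mstar
  labels_ne : ∀ a ∈ u, ∀ b ∈ u, ∀ c ∈ u, a < b → b < c →
    ({K a, K c, ℓ a c} : Set ℕ) ≠ ({K b, K c, ℓ b c} : Set ℕ)
  e_lt : ∀ a ∈ u, ∀ b ∈ u, e s(a, b) < N
  e_inj : ∀ a ∈ u, ∀ b ∈ u, ∀ c ∈ u, ∀ d ∈ u, e s(a, b) = e s(c, d) → s(a, b) = s(c, d)

namespace PreCond

variable (P : PreCond)

/-- `η_a` extended by the unit vector coding `a`. -/
def extη (a : Omega1) : List Bool := P.η a ++ unitSeq P.N (P.e s(a, a))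

/-- `ρ_{a,b}` extended by the unit vector coding `{a, b}`. -/
def extρ (a b : Omega1) : List Bool := P.ρ a b ++ unitSeq P.N (P.e s(a, b))

variable {P} {a b c d : Omega1}

theorem length_extη (ha : a ∈ P.u) : (P.extη a).length = P.n + P.N := by
  simp [extη, P.length_η a ha]

theorem length_extρ (ha : a ∈ P.u) (hb : b ∈ P.u) (hab : a ≠ b) :
    (P.extρ a b).length = P.n + P.N := by
  simp [extρ, P.length_ρ a ha b hb hab]

theorem length_topNode (ha : a ∈ P.u) (hb : b ∈ P.u) : (topNode P.η P.ρ a b).length = P.n := by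
  unfold topNode
  split_ifs with h
  · exact P.length_η a ha
  · exact length_addL (P.length_η a ha) (P.length_ρ a ha b hb h)

theorem length_topNode_ext (ha : a ∈ P.u) (hb : b ∈ P.u) :
    (topNode P.extη P.extρ a b).length = P.n + P.N := by
  unfold topNode
  split_ifs with h
  · exact length_extη ha
  · exact length_addL (length_extη ha) (length_extρ ha hb h)

theorem topNode_ext (ha : a ∈ P.u) (hb : b ∈ P.u) :
    topNode P.extη P.extρ a b = topNode P.η P.ρ a b ++
      if a = b then unitSeq P.N (P.e s(a, a))
      else addL (unitSeq P.N (P.e s(a, a))) (unitSeq P.N (P.e s(a, b))) := by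
  unfold topNode
  split_ifs with h
  · rfl
  · exact addL_append ((P.length_η a ha).trans (P.length_ρ a ha b hb h).symm)

theorem e_eq_iff (ha : a ∈ P.u) (hb : b ∈ P.u) (hc : c ∈ P.u) (hd : d ∈ P.u) :
    P.e s(a, b) = P.e s(c, d) ↔ s(a, b) = s(c, d) :=
  ⟨P.e_inj a ha b hb c hc d hd, fun h => by rw [h]⟩

theorem getElem_topNode_ext (ha : a ∈ P.u) (hb : b ∈ P.u) (hc : c ∈ P.u) (hd : d ∈ P.u) :
    (topNode P.extη P.extρ a b)[P.n + P.e s(c, d)]? =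
      some (decide (s(c, d) = s(a, a) ∨ s(c, d) = s(a, b))) := by
  have hlt := P.e_lt c hc d hd
  rw [topNode_ext ha hb, List.getElem?_append_right (by simp [length_topNode ha hb]),
    length_topNode ha hb, Nat.add_sub_cancel_left]
  split_ifs with h
  · subst h
    simp [getElem_unitSeq hlt, e_eq_iff hc hd ha ha]
  · rw [getElem_addL_unitSeq hlt]
    simp only [e_eq_iff hc hd ha ha, e_eq_iff hc hd ha hb]
    by_cases h1 : s(c, d) = s(a, a)
    · have h2 : s(a, a) ≠ s(a, b) := by simpa using h
      simp [h1, h2]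
    · simp [h1]

theorem topNode_ext_inj (ha : a ∈ P.u) (hb : b ∈ P.u) (hc : c ∈ P.u) (hd : d ∈ P.u)
    (h : topNode P.extη P.extρ a b = topNode P.extη P.extρ c d) : a = c ∧ b = d := by
  have key : ∀ x ∈ P.u, ∀ y ∈ P.u, (s(x, y) = s(a, a) ∨ s(x, y) = s(a, b)) ↔
      (s(x, y) = s(c, c) ∨ s(x, y) = s(c, d)) := by
    intro x hx y hy
    have := getElem_topNode_ext ha hb hx hy
    rw [h, getElem_topNode_ext hc hd hx hy] at this
    exact decide_eq_decide.1 (Option.some.inj this).symm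
  have h1 := (key a ha a ha).1 (Or.inl rfl)
  have h2 := (key a ha b hb).1 (Or.inr rfl)
  have h3 := (key c hc d hd).2 (Or.inr rfl)
  simp only [Sym2.eq_iff] at h1 h2 h3
  grind

theorem linearIndependent_ext : LinearIndependent (ZMod 2)
    (Sum.elim (fun a : {a : Omega1 // a ∈ P.u} => toVec (P.extη a))
      (fun q : {q : Omega1 × Omega1 // q.1 ∈ P.u ∧ q.2 ∈ P.u ∧ q.1 < q.2} =>
        toVec (P.extρ q.1.1 q.1.2))) := by
  refine LinearIndependent.of_comp (LinearMap.funLeft (ZMod 2) (ZMod 2) fun i => P.n + i) ?_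
  have hinj : Function.Injective (Sum.elim (fun a : {a : Omega1 // a ∈ P.u} => P.e s(a.1, a.1))
      (fun q : {q : Omega1 × Omega1 // q.1 ∈ P.u ∧ q.2 ∈ P.u ∧ q.1 < q.2} =>
        P.e s(q.1.1, q.1.2))) := by
    rintro (⟨a, ha⟩ | ⟨⟨a, b⟩, ha, hb, hab⟩) (⟨c, hc⟩ | ⟨⟨c, d⟩, hc, hd, hcd⟩) h <;>
      simp only [Sum.elim_inl, Sum.elim_inr] at h ha hc
    · have := P.e_inj a ha a ha c hc c hc h
      simp_all
    · have := P.e_inj a ha a ha c hc d hd h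
      simp only [Sym2.eq_iff] at this
      grind
    · have := P.e_inj a ha b hb c hc c hc h
      simp only [Sym2.eq_iff] at this
      grind
    · have := P.e_inj a ha b hb c hc d hd h
      simp only [Sym2.eq_iff] at this
      grind
  convert (Pi.linearIndependent_single_one ℕ (ZMod 2)).comp _ hinj using 1
  ext (⟨a, ha⟩ | ⟨⟨a, b⟩, ha, hb, hab⟩) i
  · have := toVec_append_unitSeq (σ := P.η a) (P.e_lt a ha a ha) i
    rwa [P.length_η a ha] at this
  · have := toVec_append_unitSeq (σ := P.ρ a b) (P.e_lt a ha b hb) i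
    rwa [P.length_ρ a ha b hb hab.ne] at this

variable (P) in
/-- The condition obtained by extending all sequences by pairwise distinct unit vectors and
letting the trees be generated by the nodes that have to belong to them. -/
noncomputable def toCond : Cond where
  u := P.u
  n := P.n + P.N
  mstar := P.mstar
  η := P.extη
  t m := {σ | ∃ a ∈ P.u, ∃ b ∈ P.u,
    topLabel P.K P.ℓ a b = m ∧ σ <+: topNode P.extη P.extρ a b}
  ρ := P.extρ
  ℓ := P.ℓ
  K := P.K
  hu := P.nonempty
  hn := Nat.add_pos_left P.n_pos _
  hm := let ⟨a, ha⟩ := P.nonempty; Nat.zero_lt_of_lt (P.K_lt a ha)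
  hη _ := length_extη
  htree m _ := by
    refine ⟨?_, ?_, ?_⟩
    · rintro σ ⟨a, ha, b, hb, -, hσ⟩
      exact hσ.length_le.trans_eq (length_topNode_ext ha hb)
    · rintro σ ⟨a, ha, b, hb, hm, hσ⟩ τ hτ
      exact ⟨a, ha, b, hb, hm, hτ.trans hσ⟩
    · rintro σ ⟨a, ha, b, hb, hm, hσ⟩ hlt
      refine ⟨_, ⟨a, ha, b, hb, hm, List.prefix_rfl⟩, hσ, ?_⟩
      rintro rfl
      exact hlt.ne (length_topNode_ext ha hb)
  hρlen _ ha _ hb := length_extρ ha hb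
  hρsym a b := by rw [extρ, extρ, P.ρ_symm a b, Sym2.eq_swap]
  hℓsym := P.ℓ_symm
  hℓlt := P.ℓ_lt
  h4 a ha b hb hab :=
    ⟨⟨a, ha, b, hb, by simp [topLabel, hab], by simp [topNode, hab]⟩,
      ⟨b, hb, a, ha, by simp [topLabel, hab.symm, P.ℓ_symm a b], by
        simp [topNode, hab.symm, extρ, P.ρ_symm a b, Sym2.eq_swap (a := a)]⟩⟩
  h5 a ha := ⟨P.K_lt a ha, a, ha, a, ha, by simp [topLabel], by simp [topNode]⟩
  h6 := P.labels_ne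
  h7 := by
    rintro m m' hlt - σ hσ ⟨a, ha, b, hb, rfl, hab⟩ ⟨c, hc, d, hd, rfl, hcd⟩
    have h1 := hab.eq_of_length (hσ.trans (length_topNode_ext ha hb).symm)
    have h2 := hcd.eq_of_length (hσ.trans (length_topNode_ext hc hd).symm)
    obtain ⟨rfl, rfl⟩ := topNode_ext_inj ha hb hc hd (h1.symm.trans h2)
    exact hlt.false
  h8 := by
    rintro m - σ ⟨a, ha, b, hb, -, hab⟩ hσ
    have h := hab.eq_of_length (hσ.trans (length_topNode_ext ha hb).symm)
    by_cases hab' : a = b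
    · exact Or.inl ⟨a, ha, by simpa [topNode, hab'] using h⟩
    · exact Or.inr ⟨a, ha, b, hb, hab', by simpa [topNode, hab'] using h⟩
  h9 := linearIndependent_ext

theorem mem_toCond_t_iff {m : ℕ} {σ : List Bool} (hσ : σ.length = P.n) :
    σ ∈ P.toCond.t m ↔ ∃ a ∈ P.u, ∃ b ∈ P.u,
      topLabel P.K P.ℓ a b = m ∧ σ = topNode P.η P.ρ a b := by
  change (∃ a ∈ P.u, ∃ b ∈ P.u, _ ∧ σ <+: _) ↔ _
  refine exists_congr fun a => and_congr_right fun ha => exists_congr fun b =>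
    and_congr_right fun hb => and_congr_right fun _ => ?_
  have hlen := hσ.trans (length_topNode ha hb).symm
  rw [topNode_ext ha hb]
  exact ⟨fun h => (List.prefix_of_prefix_length_le h (List.prefix_append _ _) hlen.le).eq_of_length
    hlen, fun h => h ▸ List.prefix_append _ _⟩

theorem le_toCond {p : Cond} (hu : p.u ⊆ P.u) (hn : p.n = P.n) (hm : p.mstar ≤ P.mstar)
    (hη : ∀ a ∈ p.u, P.η a = p.η a) (hK : ∀ a ∈ p.u, P.K a = p.K a)
    (hρ : ∀ a ∈ p.u, ∀ b ∈ p.u, P.ρ a b = p.ρ a b)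
    (hℓ : ∀ a ∈ p.u, ∀ b ∈ p.u, P.ℓ a b = p.ℓ a b)
    (ht : ∀ a ∈ P.u, ∀ b ∈ P.u, topLabel P.K P.ℓ a b < p.mstar →
      topNode P.η P.ρ a b ∈ p.t (topLabel P.K P.ℓ a b)) :
    p.Le P.toCond := by
  refine ⟨hu, hn.trans_le (Nat.le_add_right _ _), hm, fun a ha => ?_, fun m hmlt σ hσ => ?_, hK,
    fun a ha b hb hab => ⟨hℓ a ha b hb, ?_⟩⟩
  · change (P.extη a).take p.n = _
    rw [extη, hn, ← P.length_η a (hu ha), List.take_left, hη a ha]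
  · rw [mem_toCond_t_iff (hσ.trans hn)]
    constructor
    · rintro ⟨a, ha, b, hb, rfl, rfl⟩
      exact ht a ha b hb hmlt
    · rw [p.mem_t_iff hmlt hσ]
      rintro ⟨a, ha, b, hb, h1, h2⟩
      refine ⟨a, hu ha, b, hu hb, ?_, ?_⟩
      · rw [← h1]; simp [topLabel, hK a ha, hℓ a ha b hb]
      · rw [h2]; simp [topNode, hη a ha, hρ a ha b hb]
  · rw [← hρ a ha b hb]
    exact List.prefix_append _ _

end PreCond

/-- Two conditions of the same length with the same trees at the top level, agreeing on the common
part of their domains, are compatible when that common part lies below the rest. -/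
theorem Cond.exists_le_of_agree (p q : Cond) (hn : p.n = q.n) (hm : p.mstar = q.mstar)
    (hη : ∀ a ∈ p.u, a ∈ q.u → p.η a = q.η a) (hK : ∀ a ∈ p.u, a ∈ q.u → p.K a = q.K a)
    (hρ : ∀ a ∈ p.u, a ∈ q.u → ∀ b ∈ p.u, b ∈ q.u → p.ρ a b = q.ρ a b)
    (hℓ : ∀ a ∈ p.u, a ∈ q.u → ∀ b ∈ p.u, b ∈ q.u → p.ℓ a b = q.ℓ a b)
    (ht : ∀ m < p.mstar, ∀ σ : List Bool, σ.length = p.n → (σ ∈ p.t m ↔ σ ∈ q.t m))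
    (hp : ∀ c ∈ p.u, c ∈ q.u → ∀ a ∈ p.u, a ∉ q.u → c < a)
    (hq : ∀ c ∈ p.u, c ∈ q.u → ∀ a ∈ q.u, a ∉ p.u → c < a) :
    ∃ r : Cond, p.Le r ∧ q.Le r := by
  classical
  obtain ⟨e, he⟩ := countable_iff_exists_injOn.1 (p.u ∪ q.u).sym2.countable_toSet
  set N := ((p.u ∪ q.u).sym2.sup e) + 1
  have heN : ∀ a ∈ p.u ∪ q.u, ∀ b ∈ p.u ∪ q.u, e s(a, b) < N := fun a ha b hb =>
    Nat.lt_succ_of_le (Finset.le_sup (f := e) (Finset.mk_mem_sym2_iff.2 ⟨ha, hb⟩))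
  have heinj : ∀ a ∈ p.u ∪ q.u, ∀ b ∈ p.u ∪ q.u, ∀ c ∈ p.u ∪ q.u, ∀ d ∈ p.u ∪ q.u,
      e s(a, b) = e s(c, d) → s(a, b) = s(c, d) := fun a ha b hb c hc d hd h =>
    he (Finset.mem_coe.2 (Finset.mk_mem_sym2_iff.2 ⟨ha, hb⟩))
      (Finset.mem_coe.2 (Finset.mk_mem_sym2_iff.2 ⟨hc, hd⟩)) h
  let η a := if a ∈ p.u then p.η a else q.η a
  let K a := if a ∈ p.u then p.K a else q.K a
  let ρ a b := if a ∈ p.u ∧ b ∈ p.u then p.ρ a b else if a ∈ q.u ∧ b ∈ q.u then q.ρ a b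
    else List.replicate p.n false
  let ℓ a b := if a ∈ p.u ∧ b ∈ p.u then p.ℓ a b else if a ∈ q.u ∧ b ∈ q.u then q.ℓ a b
    else p.mstar + e s(a, b)
  have ηp : ∀ a ∈ p.u, η a = p.η a := fun a ha => if_pos ha
  have ηq : ∀ a ∈ q.u, η a = q.η a := fun a ha => by simp only [η]; grind
  have Kp : ∀ a ∈ p.u, K a = p.K a := fun a ha => if_pos ha
  have Kq : ∀ a ∈ q.u, K a = q.K a := fun a ha => by simp only [K]; grind
  have ρp : ∀ a ∈ p.u, ∀ b ∈ p.u, ρ a b = p.ρ a b := fun a ha b hb => if_pos ⟨ha, hb⟩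
  have ρq : ∀ a ∈ q.u, ∀ b ∈ q.u, ρ a b = q.ρ a b := fun a ha b hb => by simp only [ρ]; grind
  have ℓp : ∀ a ∈ p.u, ∀ b ∈ p.u, ℓ a b = p.ℓ a b := fun a ha b hb => if_pos ⟨ha, hb⟩
  have ℓq : ∀ a ∈ q.u, ∀ b ∈ q.u, ℓ a b = q.ℓ a b := fun a ha b hb => by simp only [ℓ]; grind
  have ℓcross : ∀ a b, ¬ (a ∈ p.u ∧ b ∈ p.u) → ¬ (a ∈ q.u ∧ b ∈ q.u) →
      ℓ a b = p.mstar + e s(a, b) := fun a b h1 h2 => by simp only [ℓ, if_neg h1, if_neg h2]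
  have Klt : ∀ a ∈ p.u ∪ q.u, K a < p.mstar := fun a ha => by
    rcases Finset.mem_union.1 ha with ha | ha
    · rw [Kp a ha]; exact (p.h5 a ha).1
    · rw [Kq a ha, hm]; exact (q.h5 a ha).1
  have ℓlt : ∀ a b, a ≠ b → (a ∈ p.u ∧ b ∈ p.u) ∨ (a ∈ q.u ∧ b ∈ q.u) → ℓ a b < p.mstar := by
    rintro a b hab (⟨ha, hb⟩ | ⟨ha, hb⟩)
    · rw [ℓp a ha b hb]; exact p.hℓlt a ha b hb hab
    · rw [ℓq a ha b hb, hm]; exact q.hℓlt a ha b hb hab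
  have hcross : ∀ a ∈ p.u ∪ q.u, ∀ b ∈ p.u ∪ q.u, ∀ c ∈ p.u ∪ q.u, ∀ d ∈ p.u ∪ q.u,
      a ≠ b → c ≠ d → ¬ (a ∈ p.u ∧ b ∈ p.u) → ¬ (a ∈ q.u ∧ b ∈ q.u) → s(a, b) ≠ s(c, d) →
      ℓ a b ≠ ℓ c d := by
    intro a ha b hb c hc d hd hab hcd h1 h2 hne h
    rw [ℓcross a b h1 h2] at h
    by_cases h3 : (c ∈ p.u ∧ d ∈ p.u) ∨ (c ∈ q.u ∧ d ∈ q.u)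
    · have := ℓlt c d hcd h3
      omega
    · rw [not_or] at h3
      rw [ℓcross c d h3.1 h3.2] at h
      exact hne (heinj a ha b hb c hc d hd (by omega))
  let P : PreCond :=
    { u := p.u ∪ q.u, n := p.n, mstar := p.mstar + N, η := η, ρ := ρ, ℓ := ℓ, K := K, e := e
      N := N
      nonempty := p.hu.mono Finset.subset_union_left
      n_pos := p.hn
      length_η := fun a ha => by
        rcases Finset.mem_union.1 ha with ha | ha
        · rw [ηp a ha]; exact p.hη a ha
        · rw [ηq a ha, hn]; exact q.hη a ha
      length_ρ := fun a _ b _ hab => by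
        simp only [ρ]
        split_ifs with h1 h2
        · exact p.hρlen a h1.1 b h1.2 hab
        · exact (q.hρlen a h2.1 b h2.2 hab).trans hn.symm
        · exact List.length_replicate
      ρ_symm := fun a b => by
        simp only [ρ, p.hρsym a b, q.hρsym a b, and_comm]
      ℓ_symm := fun a b => by
        simp only [ℓ, p.hℓsym a b, q.hℓsym a b, Sym2.eq_swap (a := a), and_comm]
      ℓ_lt := fun a ha b hb hab => by
        by_cases h : (a ∈ p.u ∧ b ∈ p.u) ∨ (a ∈ q.u ∧ b ∈ q.u)
        · exact (ℓlt a b hab h).trans_le (Nat.le_add_right _ _)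
        · rw [not_or] at h
          rw [ℓcross a b h.1 h.2]
          exact Nat.add_lt_add_left (heN a ha b hb) _
      K_lt := fun a ha => (Klt a ha).trans_le (Nat.le_add_right _ _)
      labels_ne := fun a ha b hb c hc hab hbc heq => by
        have hKa := Klt a ha
        have hKb := Klt b hb
        have hKc := Klt c hc
        have hac := hab.trans hbc
        have hne : s(a, c) ≠ s(b, c) := fun h => hab.ne (Sym2.congr_left.1 h)
        by_cases h1 : (a ∈ p.u ∧ c ∈ p.u) ∨ (a ∈ q.u ∧ c ∈ q.u)
        · by_cases h2 : (b ∈ p.u ∧ c ∈ p.u) ∨ (b ∈ q.u ∧ c ∈ q.u)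
          · by_cases h3 : a ∈ p.u ∧ b ∈ p.u ∧ c ∈ p.u
            · obtain ⟨ha, hb, hc⟩ := h3
              rw [Kp a ha, Kp b hb, Kp c hc, ℓp a ha c hc, ℓp b hb c hc] at heq
              exact p.h6 a ha b hb c hc hab hbc heq
            · by_cases h4 : a ∈ q.u ∧ b ∈ q.u ∧ c ∈ q.u
              · obtain ⟨ha, hb, hc⟩ := h4
                rw [Kq a ha, Kq b hb, Kq c hc, ℓq a ha c hc, ℓq b hb c hc] at heq
                exact q.h6 a ha b hb c hc hab hbc heq
              · have := hac.not_gt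
                have := hbc.not_gt
                grind
          · rw [not_or] at h2
            have h3 := hcross b hb c hc a ha c hc hbc.ne hac.ne h2.1 h2.2 hne.symm
            have h4 := ℓcross b c h2.1 h2.2
            have : ℓ b c ∈ ({K a, K c, ℓ a c} : Set ℕ) := heq ▸ by simp
            simp only [mem_insert_iff, mem_singleton_iff] at this
            omega
        · rw [not_or] at h1
          have h3 := hcross a ha c hc b hb c hc hac.ne hbc.ne h1.1 h1.2 hne
          have h4 := ℓcross a c h1.1 h1.2
          have : ℓ a c ∈ ({K b, K c, ℓ b c} : Set ℕ) := heq ▸ by simp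
          simp only [mem_insert_iff, mem_singleton_iff] at this
          omega
      e_lt := heN
      e_inj := heinj }
  have hmem : ∀ a ∈ P.u, ∀ b ∈ P.u, topLabel K ℓ a b < p.mstar →
      topNode η ρ a b ∈ p.t (topLabel K ℓ a b) ∧ topNode η ρ a b ∈ q.t (topLabel K ℓ a b) := by
    intro a ha b hb hlt
    have hiff := ht _ hlt _ (PreCond.length_topNode (P := P) ha hb)
    have hcases : (a ∈ p.u ∧ b ∈ p.u) ∨ (a ∈ q.u ∧ b ∈ q.u) := by
      by_contra h
      rw [not_or] at h
      have hab : a ≠ b := by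
        rintro rfl
        have := Finset.mem_union.1 ha
        tauto
      rw [topLabel, if_neg hab, ℓcross a b h.1 h.2] at hlt
      omega
    rcases hcases with ⟨ha, hb⟩ | ⟨ha, hb⟩
    · have h := p.topNode_mem ha hb
      rw [topNode, topLabel, ← ηp a ha, ← ρp a ha b hb, ← Kp a ha, ← ℓp a ha b hb] at h
      exact ⟨h, hiff.1 h⟩
    · have h := q.topNode_mem ha hb
      rw [topNode, topLabel, ← ηq a ha, ← ρq a ha b hb, ← Kq a ha, ← ℓq a ha b hb] at h
      exact ⟨hiff.2 h, h⟩
  exact ⟨P.toCond,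
    PreCond.le_toCond Finset.subset_union_left rfl (Nat.le_add_right _ _) ηp Kp ρp ℓp
      fun a ha b hb h => (hmem a ha b hb h).1,
    PreCond.le_toCond Finset.subset_union_right hn.symm (hm ▸ Nat.le_add_right _ _) ηq Kq ρq ℓq
      fun a ha b hb h => (hmem a ha b hb (hm ▸ h)).2⟩

/-- The set of nodes of maximal length in the trees of a condition, labelled by their trees, is
finite. -/
theorem Cond.finite_top (p : Cond) :
    {x : ℕ × List Bool | x.1 < p.mstar ∧ x.2.length = p.n ∧ x.2 ∈ p.t x.1}.Finite :=
  ((finite_lt_nat p.mstar).prod (List.finite_length_eq Bool p.n)).subset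
    fun _ h => ⟨h.1, h.2.1⟩

/-- ℙ has the Knaster property: any ω₁-sequence of conditions has an uncountable
subsequence of pairwise compatible conditions. -/
theorem stmt9 (p : Omega1 → Cond) :
    ∃ A : Set Omega1, ¬ A.Countable ∧
      ∀ ξ ∈ A, ∀ ζ ∈ A, ∃ r : Cond, (p ξ).Le r ∧ (p ζ).Le r := by
  classical
  obtain ⟨w, B, -, hB, hw, hd⟩ :=
    exists_not_countable_sunflower Omega1.not_countable_univ fun ξ => (p ξ).u
  have hC := not_countable_setOf_disjoint hB hd
    (w.countable_toSet.biUnion fun a _ => Omega1.countable_Iic a)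
  obtain ⟨c, hA⟩ := exists_not_countable_fiber hC fun ξ =>
    (((p ξ).n, (p ξ).mstar, (p ξ).finite_top.toFinset),
      (fun a : w => ((p ξ).η a, (p ξ).K a)),
      fun a : w × w => ((p ξ).ρ a.1 a.2, (p ξ).ℓ a.1 a.2))
  refine ⟨_, hA, ?_⟩
  rintro ξ ⟨⟨hξB, hξ⟩, hξc⟩ ζ ⟨⟨hζB, hζ⟩, hζc⟩
  by_cases hne : ξ = ζ
  · subst hne
    exact ⟨p ξ, Cond.Le.refl _, Cond.Le.refl _⟩
  have hroot : ∀ a ∈ (p ξ).u, a ∈ (p ζ).u → a ∈ w := fun a h1 h2 => by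
    by_contra h
    exact Finset.disjoint_left.1 (hd hξB hζB hne) (Finset.mem_sdiff.2 ⟨h1, h⟩)
      (Finset.mem_sdiff.2 ⟨h2, h⟩)
  have hbelow : ∀ c ∈ w, ∀ a, a ∉ ⋃ b ∈ (w : Set Omega1), Iic b → c < a := fun c hc a ha => by
    by_contra h
    exact ha (mem_biUnion (Finset.mem_coe.2 hc) (not_lt.1 h))
  have heq := hξc.trans hζc.symm
  simp only [Prod.mk.injEq] at heq
  obtain ⟨⟨hn, hm, ht⟩, hηK, hρℓ⟩ := heq
  have hηK' : ∀ a ∈ w, (p ξ).η a = (p ζ).η a ∧ (p ξ).K a = (p ζ).K a := fun a ha =>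
    Prod.mk.inj (congrFun hηK ⟨a, ha⟩)
  have hρℓ' : ∀ a ∈ w, ∀ b ∈ w, (p ξ).ρ a b = (p ζ).ρ a b ∧ (p ξ).ℓ a b = (p ζ).ℓ a b :=
    fun a ha b hb => Prod.mk.inj (congrFun hρℓ (⟨a, ha⟩, ⟨b, hb⟩))
  refine Cond.exists_le_of_agree (p ξ) (p ζ) hn hm
    (fun a h1 h2 => (hηK' a (hroot a h1 h2)).1) (fun a h1 h2 => (hηK' a (hroot a h1 h2)).2)
    (fun a h1 h2 b h3 h4 => (hρℓ' a (hroot a h1 h2) b (hroot b h3 h4)).1)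
    (fun a h1 h2 b h3 h4 => (hρℓ' a (hroot a h1 h2) b (hroot b h3 h4)).2)
    (fun m hlt σ hσ => ?_)
    (fun c h1 h2 a h3 h4 => hbelow c (hroot c h1 h2) a
      (hξ a (Finset.mem_sdiff.2 ⟨h3, fun h => h4 (hw ζ hζB h)⟩)))
    (fun c h1 h2 a h3 h4 => hbelow c (hroot c h1 h2) a
      (hζ a (Finset.mem_sdiff.2 ⟨h3, fun h => h4 (hw ξ hξB h)⟩)))
  have h := Finset.ext_iff.1 ht (m, σ)
  simpa [hlt, hσ, ← hm, ← hn] using h
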